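/- arXiv:2112.05979 — 2 statements merged into one kernel-verified Lean document; each statement's English description precedes it below -/
import Mathlib

section
/- Let n ≥ 1 and let H be a compact subgroup of the orthogonal group O(n), acting on ℝⁿ in the standard way. Call a point x ∈ ℝⁿ principal for the H-action if there exists an open neighborhood U of x such that for every y ∈ U the stabilizer subgroup H_y = {h ∈ H : h·y = y} is conjugate in H to H_x. Then the set of principal points has full Lebesgue measure in ℝⁿ, i.e. its complement is Lebesgue-null. -/
open MeasureTheory Set Matrix

/-- The stabilizer of a point `x ∈ ℝⁿ` under a set `H` of matrices acting by
`mulVec`. -/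
def matrixStabilizer {n : ℕ} (H : Set (Matrix (Fin n) (Fin n) ℝ)) (x : Fin n → ℝ) :
    Set (Matrix (Fin n) (Fin n) ℝ) :=
  {A | A ∈ H ∧ A.mulVec x = x}

/-- A point `x ∈ ℝⁿ` is *principal* for the action of `H` if it has an open
neighborhood `U` such that the stabilizer of every `y ∈ U` is conjugate in `H`
to the stabilizer of `x`. -/
def IsPrincipalPt {n : ℕ} (H : Set (Matrix (Fin n) (Fin n) ℝ)) (x : Fin n → ℝ) : Prop :=
  ∃ U : Set (Fin n → ℝ), IsOpen U ∧ x ∈ U ∧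
    ∀ y ∈ U, ∃ B ∈ H,
      matrixStabilizer H y = (fun C => B * C * B⁻¹) '' matrixStabilizer H x

open Filter Topology

/-- Second-order remainder bound for powers of `1 + E` in a normed ring. -/
theorem norm_one_add_pow_sub_le {R : Type*} [NormedRing R] (E : R) (m : ℕ) :
    ‖(1 + E) ^ m - 1 - m * E‖ ≤ (1 + ‖E‖) ^ m - 1 - m * ‖E‖ := by
  induction m with
  | zero => simp
  | succ m ih =>
    set D := (1 + E) ^ m - 1 - m * E with hD
    have h1 : (1 + E) ^ (m + 1) - 1 - ((m + 1 : ℕ) : R) * E = D + D * E + m • (E * E) := by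
      rw [hD, pow_succ, nsmul_eq_mul]
      push_cast
      noncomm_ring
    have h2 : ‖D * E‖ ≤ ‖D‖ * ‖E‖ := norm_mul_le _ _
    have h3 : ‖m • (E * E)‖ ≤ m * (‖E‖ * ‖E‖) :=
      (norm_nsmul_le).trans (mul_le_mul_of_nonneg_left (norm_mul_le _ _) (Nat.cast_nonneg m))
    have h4 : ‖D‖ * ‖E‖ ≤ ((1 + ‖E‖) ^ m - 1 - m * ‖E‖) * ‖E‖ :=
      mul_le_mul_of_nonneg_right ih (norm_nonneg _)
    rw [h1]
    calc _ ≤ ‖D‖ + ‖D * E‖ + ‖m • (E * E)‖ := norm_add₃_le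
      _ ≤ _ := by push_cast; rw [pow_succ]; nlinarith

theorem norm_one_add_pow_sub_le_sq {R : Type*} [NormedRing R] (E : R) (m : ℕ)
    (h : m * ‖E‖ ≤ 1) : ‖(1 + E) ^ m - 1 - m * E‖ ≤ (m * ‖E‖) ^ 2 := by
  have h0 : 0 ≤ m * ‖E‖ := by positivity
  have h1 : (1 + ‖E‖) ^ m ≤ Real.exp (m * ‖E‖) := by
    rw [Real.exp_nat_mul]
    gcongr
    linarith [Real.add_one_le_exp ‖E‖]
  have h2 := (abs_le.1 (Real.abs_exp_sub_one_sub_id_le (x := m * ‖E‖)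
    (by rwa [abs_of_nonneg h0]))).2
  linarith [norm_one_add_pow_sub_le E m]

/-- Submonoids containing a compact group `K` of units and accumulating only at `K` cannot all be
strictly larger than `K`. -/
theorem exists_le_of_accumulate {R : Type*} [NormedRing R] [NormedAlgebra ℝ R] [ProperSpace R]
    {C : Set R} (hC : IsCompact C) (K : Submonoid R) (hK : IsCompact (K : Set R))
    (hKinv : ∀ k ∈ K, ∃ k' ∈ K, k * k' = 1 ∧ k' * k = 1)
    (L : ℕ → Submonoid R) (hLC : ∀ i, (L i : Set R) ⊆ C) (hKL : ∀ i, K ≤ L i)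
    (hlim : ∀ φ : ℕ → ℕ, StrictMono φ → ∀ (a : ℕ → R) (b : R), (∀ i, a i ∈ L (φ i)) →
      Tendsto a atTop (𝓝 b) → b ∈ K) :
    ∃ i, L i ≤ K := by
  by_contra! hcon
  have hmin : ∀ i, ∃ l ∈ L i, l ∉ K ∧ ∀ k ∈ K, ‖l - 1‖ ≤ ‖l * k - 1‖ := by
    intro i
    obtain ⟨l, hl, hlK⟩ := SetLike.not_le_iff_exists.1 (hcon i)
    obtain ⟨k₀, hk₀, hm⟩ := hK.exists_isMinOn ⟨1, K.one_mem⟩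
      (f := fun k => ‖l * k - 1‖) (by fun_prop)
    obtain ⟨k', hk', h1, -⟩ := hKinv k₀ hk₀
    refine ⟨l * k₀, (L i).mul_mem hl (hKL i hk₀), fun h => hlK ?_, fun k hk => ?_⟩
    · have := K.mul_mem h hk'
      rwa [mul_assoc, h1, mul_one] at this
    · rw [mul_assoc]
      exact hm (K.mul_mem hk₀ hk)
  choose l hlL hlK hlmin using hmin
  obtain ⟨a, -, φ, hφ, hla⟩ := hC.tendsto_subseq (fun i => hLC i (hlL i))
  have haK : a ∈ K := hlim φ hφ _ a (fun i => hlL (φ i)) hla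
  have hδ : Tendsto (fun i => ‖l (φ i) - 1‖) atTop (𝓝 0) := by
    obtain ⟨a', ha', h1, -⟩ := hKinv a haK
    have : Tendsto (fun i => ‖l (φ i) * a' - 1‖) atTop (𝓝 0) := by
      have := ((hla.mul_const a').sub_const 1).norm
      simpa [h1] using this
    exact squeeze_zero (fun _ => norm_nonneg _) (fun i => hlmin _ a' ha') this
  have hpos : ∀ i, 0 < ‖l i - 1‖ := fun i =>
    norm_pos_iff.2 (sub_ne_zero.2 fun h => hlK i (h ▸ K.one_mem))
  obtain ⟨X, -, ψ, hψ, hX⟩ := (isCompact_sphere (0 : R) 1).tendsto_subseq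
    (x := fun i => ‖l (φ i) - 1‖⁻¹ • (l (φ i) - 1)) (fun i => by
      simp [norm_smul, (hpos (φ i)).ne'])
  set u : ℕ → R := fun i => l (φ (ψ i)) with hu
  set δ : ℕ → ℝ := fun i => ‖u i - 1‖ with hδdef
  have hδpos : ∀ i, 0 < δ i := fun i => hpos _
  have hδ0 : Tendsto δ atTop (𝓝 0) := hδ.comp hψ.tendsto_atTop
  have hX' : Tendsto (fun i => (δ i)⁻¹ • (u i - 1)) atTop (𝓝 X) := hX
  have htan : ∀ s : ℝ, 0 < s → s ≤ 1 → ∃ k ∈ K, ‖k - 1 - s • X‖ ≤ s ^ 2 := by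
    intro s hs hs1
    set m : ℕ → ℕ := fun i => ⌊s / δ i⌋₊ with hm
    have hmle : ∀ i, m i * δ i ≤ s := fun i => by
      rw [← le_div_iff₀ (hδpos i)]
      exact Nat.floor_le (by have := hδpos i; positivity)
    have hmge : ∀ i, s - δ i ≤ m i * δ i := fun i => by
      have := (Nat.lt_floor_add_one (s / δ i)).le
      rw [div_le_iff₀ (hδpos i)] at this
      linarith
    have hmt : Tendsto (fun i => m i * δ i) atTop (𝓝 s) :=
      tendsto_of_tendsto_of_tendsto_of_le_of_le (by simpa using hδ0.const_sub s)
        tendsto_const_nhds hmge hmle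
    obtain ⟨k, -, θ, hθ, hk⟩ := hC.tendsto_subseq (x := fun i => u i ^ m i)
      (fun i => hLC _ (Submonoid.pow_mem _ (hlL _) _))
    refine ⟨k, hlim (φ ∘ ψ ∘ θ) (hφ.comp (hψ.comp hθ)) _ k
      (fun i => Submonoid.pow_mem _ (hlL _) _) hk, ?_⟩
    have hbound : ∀ i, ‖u i ^ m i - 1 - (m i * δ i) • ((δ i)⁻¹ • (u i - 1))‖ ≤ s ^ 2 := by
      intro i
      have h := norm_one_add_pow_sub_le_sq (u i - 1) (m i) ((hmle i).trans hs1)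
      rw [add_sub_cancel] at h
      have h3 : (m i * δ i) • ((δ i)⁻¹ • (u i - 1)) = (m i : R) * (u i - 1) := by
        rw [smul_smul, mul_assoc, mul_inv_cancel₀ (hδpos i).ne', mul_one, Nat.cast_smul_eq_nsmul,
          nsmul_eq_mul]
      rw [h3]
      refine h.trans ?_
      have := hmle i
      have h0 : 0 ≤ m i * δ i := by have := hδpos i; positivity
      gcongr
    have hlim2 : Tendsto (fun i => u (θ i) ^ m (θ i) - 1 -
        (m (θ i) * δ (θ i)) • ((δ (θ i))⁻¹ • (u (θ i) - 1))) atTop (𝓝 (k - 1 - s • X)) :=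
      (hk.sub_const 1).sub ((hmt.comp hθ.tendsto_atTop).smul (hX'.comp hθ.tendsto_atTop))
    exact le_of_tendsto' hlim2.norm fun i => hbound (θ i)
  obtain ⟨M, hM⟩ := hK.isBounded.exists_norm_le
  have hM0 : 0 ≤ M := (norm_nonneg _).trans (hM 1 K.one_mem)
  have hev : Tendsto (fun i => (‖(δ i)⁻¹ • (u i - 1) - X‖ + δ i) * M) atTop (𝓝 0) := by
    have := (((hX'.sub_const X).norm).add hδ0).mul_const M
    simpa using this
  obtain ⟨i, hi1, hi2⟩ := ((hev.eventually_lt_const one_pos).and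
    (hδ0.eventually_le_const one_pos)).exists
  obtain ⟨k, hk, hkb⟩ := htan (δ i) (hδpos i) hi2
  obtain ⟨k', hk', hkk', -⟩ := hKinv k hk
  have h1 : δ i ≤ ‖u i * k' - 1‖ := hlmin _ k' hk'
  have h2 : u i * k' - 1 = (u i - k) * k' := by rw [sub_mul, hkk']
  have h3 : u i - k = δ i • ((δ i)⁻¹ • (u i - 1) - X) - (k - 1 - δ i • X) := by
    rw [smul_sub, smul_smul, mul_inv_cancel₀ (hδpos i).ne', one_smul]
    abel
  have h4 : ‖u i - k‖ ≤ δ i * (‖(δ i)⁻¹ • (u i - 1) - X‖ + δ i) := by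
    rw [h3]
    refine (norm_sub_le _ _).trans ?_
    rw [norm_smul, Real.norm_of_nonneg (hδpos i).le]
    nlinarith
  have h5 : ‖u i * k' - 1‖ ≤ δ i * (‖(δ i)⁻¹ • (u i - 1) - X‖ + δ i) * M := by
    rw [h2]
    refine (norm_mul_le _ _).trans ?_
    have h6 := hM k' hk'
    exact mul_le_mul h4 h6 (norm_nonneg _) (by have := hδpos i; positivity)
  have := hδpos i
  nlinarith

/-- For almost every `y`, a linear functional `p ↦ p ⬝ᵥ y` attains its maximum over a compact set
at a single point. -/
theorem ae_existsUnique_isMaxOn_dotProduct {n : ℕ} {P : Set (Fin n → ℝ)} (hP : IsCompact P)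
    (hne : P.Nonempty) :
    ∀ᵐ y : Fin n → ℝ, ∃ p ∈ P, ∀ q ∈ P, p ⬝ᵥ y ≤ q ⬝ᵥ y → q = p := by
  have hmax : ∀ y : Fin n → ℝ, ∃ p ∈ P, ∀ q ∈ P, q ⬝ᵥ y ≤ p ⬝ᵥ y := fun y =>
    hP.exists_isMaxOn hne (f := fun q => q ⬝ᵥ y)
      ((continuous_id.dotProduct continuous_const).continuousOn)
  choose p hpP hp using hmax
  set f : (Fin n → ℝ) → ℝ := fun y => p y ⬝ᵥ y with hf
  obtain ⟨M, hM⟩ := hP.isBounded.exists_norm_le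
  have hM0 : 0 ≤ M := (norm_nonneg _).trans (hM _ (hpP 0))
  have hdot : ∀ q ∈ P, ∀ v : Fin n → ℝ, q ⬝ᵥ v ≤ n * M * ‖v‖ := by
    intro q hq v
    calc q ⬝ᵥ v ≤ ∑ _i : Fin n, M * ‖v‖ := by
          refine Finset.sum_le_sum fun i _ => (le_abs_self _).trans ?_
          rw [abs_mul]
          exact mul_le_mul ((norm_le_pi_norm q i).trans (hM q hq)) (norm_le_pi_norm v i)
            (abs_nonneg _) hM0
      _ = _ := by simp [mul_assoc]
  have hlip : LipschitzWith (n * M).toNNReal f := by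
    refine LipschitzWith.of_le_add_mul' _ fun y z => ?_
    have h1 := hp z (p y) (hpP y)
    have h2 := hdot (p y) (hpP y) (y - z)
    rw [dotProduct_sub] at h2
    rw [dist_eq_norm]
    simp only [hf]
    linarith
  filter_upwards [hlip.ae_differentiableAt (μ := volume)] with y hy
  have key : ∀ q ∈ P, p y ⬝ᵥ y ≤ q ⬝ᵥ y → ∀ v, fderiv ℝ f y v = q ⬝ᵥ v := by
    intro q hq hqy
    set A : (Fin n → ℝ) →L[ℝ] ℝ :=
      LinearMap.toContinuousLinearMap (dotProductBilin ℝ ℝ q) with hA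
    have hAv : ∀ v, A v = q ⬝ᵥ v := fun v => rfl
    have hmin : IsLocalMin (fun z => f z - A z) y := by
      refine Filter.Eventually.of_forall fun z => ?_
      simp only [hAv, hf]
      linarith [hp z q hq, hp y q hq]
    have := hmin.hasFDerivAt_eq_zero (hy.hasFDerivAt.sub A.hasFDerivAt)
    intro v
    rw [sub_eq_zero.1 this, hAv]
  refine ⟨p y, hpP y, fun q hq h => ?_⟩
  refine dotProduct_eq _ _ fun v => ?_
  rw [← key q hq h, ← key (p y) (hpP y) le_rfl]

/-- In a compact set of orthogonal matrices, the transpose of a matrix all of whose powers lie in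
the set is a limit of those powers. -/
theorem exists_tendsto_pow_transpose {n : ℕ} {H : Set (Matrix (Fin n) (Fin n) ℝ)}
    (hH : IsCompact H) (h_orth : ∀ A ∈ H, A * Aᵀ = 1) {g : Matrix (Fin n) (Fin n) ℝ}
    (hg : ∀ m : ℕ, g ^ m ∈ H) :
    ∃ m : ℕ → ℕ, Tendsto (fun i => g ^ m i) atTop (𝓝 gᵀ) := by
  have : FirstCountableTopology (Matrix (Fin n) (Fin n) ℝ) :=
    inferInstanceAs (FirstCountableTopology (Fin n → Fin n → ℝ))
  obtain ⟨a, haH, φ, hφ, ha⟩ := hH.tendsto_subseq hg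
  have hgg : g * gᵀ = 1 := h_orth g (by simpa using hg 1)
  refine ⟨fun i => φ (i + 1) - φ i - 1, ?_⟩
  have h1 : Tendsto (fun i => g ^ φ (i + 1) * (g ^ φ i)ᵀ * gᵀ) atTop (𝓝 gᵀ) := by
    have hT : Tendsto (fun i => (g ^ φ i)ᵀ) atTop (𝓝 aᵀ) :=
      (continuous_id.matrix_transpose.tendsto a).comp ha
    have := ((ha.comp (tendsto_add_atTop_nat 1)).mul hT).mul_const gᵀ
    rwa [h_orth a haH, one_mul] at this
  refine h1.congr fun i => ?_
  obtain ⟨d, hd⟩ := Nat.exists_eq_add_of_lt (hφ (Nat.lt_succ_self i))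
  have h2 : φ (i + 1) = d + 1 + φ i := by simpa using hd.trans (by ring)
  have h3 : φ (i + 1) - φ i - 1 = d := by omega
  simp only
  rw [h3, h2, pow_add, mul_assoc (g ^ (d + 1)), h_orth _ (hg _), mul_one, pow_succ, mul_assoc,
    hgg, mul_one]

theorem isCompact_of_isClosed_orthogonal {n : ℕ} {H : Set (Matrix (Fin n) (Fin n) ℝ)}
    (h_orth : ∀ A ∈ H, A * Aᵀ = 1) (h_closed : IsClosed H) : IsCompact H := by
  have hbox : IsCompact (Set.univ.pi fun _ : Fin n => Set.univ.pi fun _ : Fin n =>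
      Set.Icc (-1 : ℝ) 1) :=
    isCompact_univ_pi fun _ => isCompact_univ_pi fun _ => isCompact_Icc
  refine hbox.of_isClosed_subset h_closed fun (A : Matrix (Fin n) (Fin n) ℝ) hA i _ j _ => ?_
  have h1 : ∑ k, A i k * A i k = 1 := by
    have h : (A * Aᵀ) i i = (1 : Matrix (Fin n) (Fin n) ℝ) i i := by
      rw [h_orth A hA]
    rwa [Matrix.mul_apply, one_apply_eq] at h
  have h2 : A i j * A i j ≤ 1 := h1 ▸ Finset.single_le_sum
    (f := fun k => A i k * A i k) (fun k _ => mul_self_nonneg _) (Finset.mem_univ j)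
  exact abs_le.1 (abs_le_one_iff_mul_self_le_one.2 h2)

/-- Almost every stabilizer is subconjugate to all stabilizers. -/
theorem ae_forall_exists_stabilizer_subconj {n : ℕ} {H : Set (Matrix (Fin n) (Fin n) ℝ)}
    (hH : IsCompact H) (h_orth : ∀ A ∈ H, A * Aᵀ = 1)
    (h_one : (1 : Matrix (Fin n) (Fin n) ℝ) ∈ H) (h_mul : ∀ A ∈ H, ∀ B ∈ H, A * B ∈ H) :
    ∀ᵐ y : Fin n → ℝ, ∀ x : Fin n → ℝ, ∃ g ∈ H, ∀ a ∈ matrixStabilizer H y,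
      a *ᵥ (g *ᵥ x) = g *ᵥ x := by
  have : FirstCountableTopology (Matrix (Fin n) (Fin n) ℝ) :=
    inferInstanceAs (FirstCountableTopology (Fin n → Fin n → ℝ))
  have hae : ∀ x : Fin n → ℝ, ∀ᵐ y : Fin n → ℝ, ∃ g ∈ H, ∀ a ∈ matrixStabilizer H y,
      a *ᵥ (g *ᵥ x) = g *ᵥ x := by
    intro x
    have hP : IsCompact ((fun g : Matrix (Fin n) (Fin n) ℝ => g *ᵥ x) '' H) :=
      hH.image (continuous_id.matrix_mulVec continuous_const)
    filter_upwards [ae_existsUnique_isMaxOn_dotProduct hP ⟨_, 1, h_one, rfl⟩] with y hy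
    obtain ⟨_, ⟨g, hg, rfl⟩, huniq⟩ := hy
    refine ⟨g, hg, fun a ha => huniq _ ⟨a * g, h_mul a ha.1 g hg, ?_⟩ (le_of_eq ?_)⟩
    · simp
    · have h1 : aᵀ *ᵥ y = y := by
        conv_lhs => rw [← ha.2]
        rw [mulVec_mulVec, mul_eq_one_comm.1 (h_orth a ha.1), one_mulVec]
      conv_lhs => rw [← h1]
      simp only
      rw [dotProduct_mulVec, vecMul_transpose]
  have hall := ae_all_iff.2 fun i : ℕ => hae (TopologicalSpace.denseSeq (Fin n → ℝ) i)
  filter_upwards [hall] with y hy x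
  obtain ⟨w, hw, hwx⟩ := mem_closure_iff_seq_limit.1
    (TopologicalSpace.denseRange_denseSeq (Fin n → ℝ) x)
  have hw' : ∀ i, ∃ g ∈ H, ∀ a ∈ matrixStabilizer H y, a *ᵥ (g *ᵥ w i) = g *ᵥ w i := by
    intro i
    obtain ⟨j, hj⟩ := hw i
    exact hj ▸ hy j
  choose g hg hgw using hw'
  obtain ⟨b, hb, φ, hφ, hgb⟩ := hH.tendsto_subseq hg
  have hlim : Tendsto (fun i => g (φ i) *ᵥ w (φ i)) atTop (𝓝 (b *ᵥ x)) :=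
    ((continuous_fst.matrix_mulVec continuous_snd).tendsto (b, x)).comp
      (hgb.prodMk_nhds (hwx.comp hφ.tendsto_atTop))
  refine ⟨b, hb, fun a ha => ?_⟩
  have hlim2 : Tendsto (fun i => a *ᵥ (g (φ i) *ᵥ w (φ i))) atTop (𝓝 (a *ᵥ (b *ᵥ x))) :=
    ((continuous_const.matrix_mulVec continuous_id).tendsto _).comp hlim
  exact tendsto_nhds_unique hlim2 (hlim.congr fun i => (hgw _ a ha).symm)

/-- A point whose stabilizer is subconjugate to all stabilizers is principal. -/
theorem isPrincipalPt_of_forall_stabilizer_subconj {n : ℕ} {H : Set (Matrix (Fin n) (Fin n) ℝ)}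
    (hH : IsCompact H) (h_orth : ∀ A ∈ H, A * Aᵀ = 1)
    (h_one : (1 : Matrix (Fin n) (Fin n) ℝ) ∈ H) (h_mul : ∀ A ∈ H, ∀ B ∈ H, A * B ∈ H)
    (h_inv : ∀ A ∈ H, Aᵀ ∈ H) {y : Fin n → ℝ}
    (hy : ∀ x : Fin n → ℝ, ∃ g ∈ H, ∀ a ∈ matrixStabilizer H y, a *ᵥ (g *ᵥ x) = g *ᵥ x) :
    IsPrincipalPt H y := by
  let : NormedRing (Matrix (Fin n) (Fin n) ℝ) := Matrix.linftyOpNormedRing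
  let : NormedAlgebra ℝ (Matrix (Fin n) (Fin n) ℝ) := Matrix.linftyOpNormedAlgebra
  have : FirstCountableTopology (Matrix (Fin n) (Fin n) ℝ) :=
    inferInstanceAs (FirstCountableTopology (Fin n → Fin n → ℝ))
  have : ProperSpace (Matrix (Fin n) (Fin n) ℝ) := FiniteDimensional.proper_real _
  have h_orth' : ∀ A ∈ H, Aᵀ * A = 1 := fun A hA => mul_eq_one_comm.1 (h_orth A hA)
  have hcont : Continuous fun q : Matrix (Fin n) (Fin n) ℝ × (Fin n → ℝ) => q.1 *ᵥ q.2 :=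
    continuous_fst.matrix_mulVec continuous_snd
  by_contra hnp
  have hbad : y ∈ closure {x | ¬ ∃ B ∈ H, matrixStabilizer H x =
      (fun C => B * C * B⁻¹) '' matrixStabilizer H y} := by
    rw [mem_closure_iff]
    intro U hU hyU
    by_contra hemp
    exact hnp ⟨U, hU, hyU, fun x hx => by_contra fun h => hemp ⟨x, hx, h⟩⟩
  obtain ⟨x, hx, hxy⟩ := mem_closure_iff_seq_limit.1 hbad
  choose g₀ hg₀ hgx₀ using fun i => hy (x i)
  obtain ⟨g, hg, φ, hφ, hgg⟩ := hH.tendsto_subseq hg₀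
  set z : ℕ → Fin n → ℝ := fun i => g₀ (φ i) *ᵥ x (φ i) with hz
  have hzlim : Tendsto z atTop (𝓝 (g *ᵥ y)) :=
    (hcont.tendsto (g, y)).comp (hgg.prodMk_nhds (hxy.comp hφ.tendsto_atTop))
  let S : (Fin n → ℝ) → Submonoid (Matrix (Fin n) (Fin n) ℝ) := fun v =>
    { carrier := matrixStabilizer H v
      one_mem' := ⟨h_one, one_mulVec v⟩
      mul_mem' := fun {a b} ha hb => ⟨h_mul a ha.1 b hb.1, by
        rw [← mulVec_mulVec, hb.2, ha.2]⟩ }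
  have hSclosed : ∀ v, IsCompact (S v : Set (Matrix (Fin n) (Fin n) ℝ)) := fun v =>
    hH.inter_right (isClosed_eq (continuous_id.matrix_mulVec continuous_const) continuous_const)
  have hfix : ∀ a ∈ S y, a *ᵥ (g *ᵥ y) = g *ᵥ y := by
    intro a ha
    have h1 : Tendsto (fun i => a *ᵥ z i) atTop (𝓝 (a *ᵥ (g *ᵥ y))) :=
      ((continuous_const.matrix_mulVec continuous_id).tendsto _).comp hzlim
    exact tendsto_nhds_unique h1 (hzlim.congr fun i => (hgx₀ _ a ha).symm)
  -- conjugation by `gᵀ` maps the stabilizer into itself, hence onto itself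
  have hconj : ∀ a ∈ S y, gᵀ * a * g ∈ S y := fun a ha =>
    ⟨h_mul _ (h_mul _ (h_inv g hg) _ ha.1) _ hg, by
      rw [← mulVec_mulVec, ← mulVec_mulVec, hfix a ha, mulVec_mulVec, h_orth' g hg, one_mulVec]⟩
  have hconj' : ∀ a ∈ S y, g * a * gᵀ ∈ S y := by
    have hpow : ∀ m : ℕ, (gᵀ) ^ m ∈ H := fun m => by
      induction m with
      | zero => simpa using h_one
      | succ m ih => rw [pow_succ]; exact h_mul _ ih _ (h_inv g hg)
    obtain ⟨m, hm⟩ := exists_tendsto_pow_transpose hH h_orth hpow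
    rw [transpose_transpose] at hm
    intro a ha
    have h1 : ∀ m : ℕ, (gᵀ) ^ m * a * ((gᵀ) ^ m)ᵀ ∈ S y := fun m => by
      induction m with
      | zero => simpa using ha
      | succ m ih =>
        have := hconj _ ih
        rw [pow_succ', transpose_mul, transpose_transpose]
        simpa only [mul_assoc] using this
    have hT : Tendsto (fun i => ((gᵀ) ^ m i)ᵀ) atTop (𝓝 gᵀ) :=
      (continuous_id.matrix_transpose.tendsto g).comp hm
    exact (hSclosed y).isClosed.mem_of_tendsto ((hm.mul_const a).mul hT)
      (Eventually.of_forall fun i => h1 (m i))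
  have hSg : ∀ a ∈ S (g *ᵥ y), a ∈ S y := by
    intro a ha
    have h1 : gᵀ * a * g ∈ S y := ⟨h_mul _ (h_mul _ (h_inv g hg) _ ha.1) _ hg, by
      rw [← mulVec_mulVec, ← mulVec_mulVec, ha.2, mulVec_mulVec, h_orth' g hg, one_mulVec]⟩
    have h2 := hconj' _ h1
    have h3 : g * (gᵀ * a * g) * gᵀ = (g * gᵀ) * a * (g * gᵀ) := by simp only [mul_assoc]
    rwa [h3, h_orth g hg, one_mul, mul_one] at h2
  obtain ⟨i, hi⟩ := exists_le_of_accumulate hH (S y) (hSclosed y)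
    (fun k hk => ⟨kᵀ, ⟨h_inv k hk.1, by
      conv_lhs => rw [← hk.2]
      rw [mulVec_mulVec, h_orth' k hk.1, one_mulVec]⟩, h_orth k hk.1, h_orth' k hk.1⟩)
    (fun i => S (z i)) (fun i a ha => ha.1) (fun i a ha => ⟨ha.1, hgx₀ _ a ha⟩)
    (fun θ hθ a b ha hab => hSg b
      ⟨hH.isClosed.mem_of_tendsto hab (Eventually.of_forall fun i => (ha i).1), by
        have h1 : Tendsto (fun i => a i *ᵥ z (θ i)) atTop (𝓝 (b *ᵥ (g *ᵥ y))) :=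
          (hcont.tendsto (b, g *ᵥ y)).comp (hab.prodMk_nhds (hzlim.comp hθ.tendsto_atTop))
        exact tendsto_nhds_unique h1
          ((hzlim.comp hθ.tendsto_atTop).congr fun i => (ha i).2.symm)⟩)
  refine hx (φ i) ⟨(g₀ (φ i))ᵀ, h_inv _ (hg₀ _), ?_⟩
  have hp := hg₀ (φ i)
  have hgx := hgx₀ (φ i)
  set p := g₀ (φ i) with hpdef
  have hinv : (pᵀ)⁻¹ = p := inv_eq_right_inv (h_orth' p hp)
  rw [hinv]
  ext a
  constructor
  · intro ha
    refine ⟨p * a * pᵀ, hi ⟨h_mul _ (h_mul _ hp _ ha.1) _ (h_inv p hp), ?_⟩, ?_⟩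
    · change (p * a * pᵀ) *ᵥ (p *ᵥ x (φ i)) = p *ᵥ x (φ i)
      rw [mulVec_mulVec, mul_assoc, h_orth' p hp, mul_one, ← mulVec_mulVec, ha.2]
    · have h3 : pᵀ * (p * a * pᵀ) * p = (pᵀ * p) * a * (pᵀ * p) := by simp only [mul_assoc]
      simp only
      rw [h3, h_orth' p hp, one_mul, mul_one]
  · rintro ⟨c, hc, rfl⟩
    refine ⟨h_mul _ (h_mul _ (h_inv p hp) _ hc.1) _ hp, ?_⟩
    simp only
    rw [← mulVec_mulVec, ← mulVec_mulVec, hgx c hc, mulVec_mulVec, h_orth' p hp, one_mulVec]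

/-- For a compact (closed) subgroup `H` of the orthogonal group `O(n)` acting
on `ℝⁿ` in the standard way, the set of principal points has full Lebesgue
measure: its complement is Lebesgue-null. -/
theorem principal_points_full_measure
    (n : ℕ) (hn : 1 ≤ n)
    (H : Set (Matrix (Fin n) (Fin n) ℝ))
    (h_orth : ∀ A ∈ H, A * Aᵀ = 1)
    (h_one : (1 : Matrix (Fin n) (Fin n) ℝ) ∈ H)
    (h_mul : ∀ A ∈ H, ∀ B ∈ H, A * B ∈ H)
    (h_inv : ∀ A ∈ H, A⁻¹ ∈ H)
    (h_closed : IsClosed H) :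
    volume {x : Fin n → ℝ | ¬ IsPrincipalPt H x} = 0 := by
  have hH : IsCompact H := isCompact_of_isClosed_orthogonal h_orth h_closed
  have h_tr : ∀ A ∈ H, Aᵀ ∈ H := fun A hA =>
    inv_eq_right_inv (h_orth A hA) ▸ h_inv A hA
  rw [← ae_iff]
  filter_upwards [ae_forall_exists_stabilizer_subconj hH h_orth h_one h_mul] with y hy
  exact isPrincipalPt_of_forall_stabilizer_subconj hH h_orth h_one h_mul h_tr hy
end

section
/- Let n ≥ 2 and let H be a compact subgroup of the orthogonal group O(n), acting on the unit sphere S^{n−1} ⊂ ℝⁿ. Call a point x ∈ S^{n−1} principal for the H-action on the sphere if there exists a relatively open neighborhood U of x in S^{n−1} such that for every y ∈ U the stabilizer subgroup H_y = {h ∈ H : h·y = y} is conjugate in H to H_x. Then the set of principal points has full measure in S^{n−1} with respect to the (n−1)-dimensional Hausdorff measure (spherical surface measure), i.e. its complement is a null set for that measure. -/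
open MeasureTheory Set Matrix

/-- The stabilizer of a point `x` of Euclidean space under a set `H` of
matrices acting via `Matrix.toEuclideanLin`. -/
def sphereStabilizer {n : ℕ} (H : Set (Matrix (Fin n) (Fin n) ℝ))
    (x : EuclideanSpace ℝ (Fin n)) : Set (Matrix (Fin n) (Fin n) ℝ) :=
  {A | A ∈ H ∧ Matrix.toEuclideanLin A x = x}

/-- A point `x ∈ S^{n-1}` is *principal* for the `H`-action on the sphere if it
has a relatively open neighborhood `U ∩ S^{n-1}` (with `U` open in `ℝⁿ`) such
that the stabilizer of every `y` in it is conjugate in `H` to the stabilizer of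
`x`. -/
def IsSpherePrincipalPt {n : ℕ} (H : Set (Matrix (Fin n) (Fin n) ℝ))
    (x : EuclideanSpace ℝ (Fin n)) : Prop :=
  ∃ U : Set (EuclideanSpace ℝ (Fin n)), IsOpen U ∧ x ∈ U ∧
    ∀ y ∈ U ∩ Metric.sphere (0 : EuclideanSpace ℝ (Fin n)) 1, ∃ B ∈ H,
      sphereStabilizer H y = (fun C => B * C * B⁻¹) '' sphereStabilizer H x

open Module Filter Topology

section OrthogonalRepresentation

variable {E : Type*} [NormedAddCommGroup E] [InnerProductSpace ℝ E]
variable {G : Type*} [Group G]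

/-- The subspace of vectors fixed by the stabilizer of `y`. -/
def stabilizerFixedSpace (ρ : G →* (E →L[ℝ] E)) (y : E) : Submodule ℝ E where
  carrier := {w | ∀ g, ρ g y = y → ρ g w = w}
  add_mem' ha hb g hg := by rw [map_add, ha g hg, hb g hg]
  zero_mem' g _ := map_zero _
  smul_mem' c w hw g hg := by rw [map_smul, hw g hg]

theorem mem_stabilizerFixedSpace {ρ : G →* (E →L[ℝ] E)} {y w : E} :
    w ∈ stabilizerFixedSpace ρ y ↔ ∀ g, ρ g y = y → ρ g w = w := Iff.rfl

theorem self_mem_stabilizerFixedSpace (ρ : G →* (E →L[ℝ] E)) (y : E) :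
    y ∈ stabilizerFixedSpace ρ y := fun _ h => h

theorem map_mul_apply_eq (ρ : G →* (E →L[ℝ] E)) (g h : G) (x : E) :
    ρ (g * h) x = ρ g (ρ h x) := by rw [map_mul]; rfl

theorem map_inv_apply_apply (ρ : G →* (E →L[ℝ] E)) (g : G) (x : E) :
    ρ g⁻¹ (ρ g x) = x := by rw [← map_mul_apply_eq]; simp

theorem map_apply_inv_apply (ρ : G →* (E →L[ℝ] E)) (g : G) (x : E) :
    ρ g (ρ g⁻¹ x) = x := by rw [← map_mul_apply_eq]; simp

theorem map_conj_apply_eq_iff (ρ : G →* (E →L[ℝ] E)) (g h : G) (x : E) :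
    ρ (h⁻¹ * g * h) x = x ↔ ρ g (ρ h x) = ρ h x := by
  rw [map_mul_apply_eq, map_mul_apply_eq]
  constructor
  · intro H
    rw [← map_apply_inv_apply ρ h (ρ g (ρ h x)), H]
  · intro H
    rw [H, map_inv_apply_apply]

theorem stabilizerFixedSpace_smul (ρ : G →* (E →L[ℝ] E)) {t : ℝ} (ht : t ≠ 0) (y : E) :
    stabilizerFixedSpace ρ (t • y) = stabilizerFixedSpace ρ y := by
  ext w
  simp only [mem_stabilizerFixedSpace, map_smul]
  simp [smul_right_injective E ht |>.eq_iff]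

/-- Two distinct vectors of equal norm have a midpoint of strictly smaller norm, so that the
element of least norm in a convex set is unique. -/
theorem eq_of_norm_eq_of_norm_le_midpoint {a b : E} (h : ‖a‖ = ‖b‖)
    (hm : ‖a‖ ≤ ‖(1 / 2 : ℝ) • (a + b)‖) : a = b := by
  have h1 := parallelogram_law_with_norm ℝ a b
  rw [norm_smul] at hm
  norm_num at hm
  have h2 : ‖a - b‖ * ‖a - b‖ ≤ 0 := by
    have := norm_nonneg a
    rw [← h] at h1
    nlinarith
  have h3 : ‖a - b‖ = 0 := by nlinarith [norm_nonneg (a - b)]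
  exact sub_eq_zero.1 (norm_eq_zero.1 h3)

variable [FiniteDimensional ℝ E]

/-- If the subgroup `L` moves `w` by at most `ε`, then `L` fixes a point within `ε` of `w`. -/
theorem exists_fixed_near (ρ : G →* (E →L[ℝ] E)) (hiso : ∀ g x, ‖ρ g x‖ = ‖x‖)
    (L : Subgroup G) (w : E) {ε : ℝ} (hw : ∀ g ∈ L, ‖ρ g w - w‖ ≤ ε) :
    ∃ c, (∀ g ∈ L, ρ g c = c) ∧ ‖c - w‖ ≤ ε := by
  set C : Set E := ⋂ g ∈ L, Metric.closedBall (ρ g w) ε with hC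
  have memC : ∀ c, c ∈ C ↔ ∀ g ∈ L, ‖c - ρ g w‖ ≤ ε := by
    intro c; simp [hC, dist_eq_norm]
  have hne : C.Nonempty := ⟨w, (memC w).2 fun g hg => by rw [norm_sub_rev]; exact hw g hg⟩
  have hball : C ⊆ Metric.closedBall w ε := fun c hc => by
    simpa [dist_eq_norm] using (memC c).1 hc 1 L.one_mem
  have hcl : IsClosed C := isClosed_biInter fun g _ => Metric.isClosed_closedBall
  have hcvx : Convex ℝ C := convex_iInter₂ fun g _ => convex_closedBall _ _
  have hcpt : IsCompact C := (isCompact_closedBall w ε).of_isClosed_subset hcl hball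
  obtain ⟨c, hc, hmin⟩ := hcpt.exists_isMinOn hne continuous_norm.continuousOn
  refine ⟨c, fun g hg => ?_, by simpa [dist_eq_norm] using hball hc⟩
  have hgc : ρ g c ∈ C := (memC _).2 fun k hk => by
    have h1 := (memC c).1 hc (g⁻¹ * k) (L.mul_mem (L.inv_mem hg) hk)
    rwa [map_mul_apply_eq, ← hiso g, map_sub, map_apply_inv_apply] at h1
  refine eq_of_norm_eq_of_norm_le_midpoint (hiso g c) ?_
  rw [hiso]
  refine hmin ?_
  rw [smul_add]
  exact hcvx hgc hc (by norm_num) (by norm_num) (by norm_num)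

/-- The dimension of the subspace fixed by the stabilizer of a point is lower semicontinuous. -/
theorem eventually_finrank_stabilizerFixedSpace_le [TopologicalSpace G] [CompactSpace G]
    (ρ : G →* (E →L[ℝ] E)) (hiso : ∀ g x, ‖ρ g x‖ = ‖x‖) (hcont : Continuous ρ) (v : E) :
    ∀ᶠ z in 𝓝 v,
      finrank ℝ (stabilizerFixedSpace ρ v) ≤ finrank ℝ (stabilizerFixedSpace ρ z) := by
  have hjoint : Continuous fun p : G × E => ρ p.1 p.2 := by fun_prop
  set W := stabilizerFixedSpace ρ v
  set K : Set (G × E) := (univ ×ˢ ((W : Set E) ∩ Metric.closedBall 0 1)) ∩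
    {p | 1 / 2 ≤ ‖ρ p.1 p.2 - p.2‖}
  have hK : IsCompact K := by
    refine (isCompact_univ.prod ?_).inter_right ?_
    · exact (isCompact_closedBall 0 1).inter_left W.closed_of_finiteDimensional
    · exact isClosed_le continuous_const (by fun_prop)
  have key : ∀ᶠ z in 𝓝 v, ∀ p ∈ K, ρ p.1 z ≠ z := by
    refine hK.eventually_forall_of_forall_eventually fun p hp => ?_
    have hop : IsOpen {q : E × (G × E) | ρ q.2.1 q.1 ≠ q.1} :=
      isOpen_ne_fun (by fun_prop) (by fun_prop)
    refine hop.mem_nhds ?_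
    intro h
    obtain ⟨⟨-, hpW, -⟩, hp2⟩ := hp
    have : ρ p.1 p.2 = p.2 := hpW p.1 h
    simp only [mem_ofPred_eq, this, sub_self, norm_zero] at hp2
    norm_num at hp2
  filter_upwards [key] with z hz
  set V := stabilizerFixedSpace ρ z
  let L : Subgroup G :=
    { carrier := {g | ρ g z = z}
      mul_mem' := fun {a b} ha hb => by
        simp only [mem_ofPred_eq] at *
        rw [map_mul_apply_eq, hb, ha]
      one_mem' := by simp
      inv_mem' := fun {a} ha => by
        simp only [mem_ofPred_eq] at *
        conv_lhs => rw [← ha]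
        exact map_inv_apply_apply ρ a z }
  have hnear : ∀ w ∈ W, ‖w‖ ≤ 1 → ∃ c ∈ V, ‖c - w‖ ≤ 1 / 2 := by
    intro w hw hw1
    refine exists_fixed_near ρ hiso L w fun g hg => ?_
    by_contra! hlt
    exact hz (g, w) ⟨⟨mem_univ _, hw, by simpa using hw1⟩, hlt.le⟩ hg
  refine LinearMap.finrank_le_finrank_of_injective
    (f := V.orthogonalProjectionOnto.toLinearMap ∘ₗ W.subtype) ?_
  rw [injective_iff_map_eq_zero]
  rintro ⟨w, hw⟩ hPw
  by_contra hne
  have hw0 : w ≠ 0 := fun h => hne (Subtype.ext h)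
  obtain ⟨c, hcV, hc⟩ := hnear (‖w‖⁻¹ • w) (W.smul_mem _ hw)
    (norm_smul_inv_norm (𝕜 := ℝ) hw0).le
  have hwV : w ∈ Vᗮ := by
    simpa using hPw
  have hin : inner ℝ c (‖w‖⁻¹ • w) = 0 := Submodule.smul_mem _ _ hwV c hcV
  have h1 : ‖(‖w‖⁻¹ • w)‖ = 1 := norm_smul_inv_norm (𝕜 := ℝ) hw0
  have h2 := norm_sub_sq_real c (‖w‖⁻¹ • w)
  rw [hin, h1] at h2
  nlinarith [norm_nonneg (c - ‖w‖⁻¹ • w), sq_nonneg ‖c‖]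

/-- If the stabilizer of `y` fixes `h • v`, then the subspace attached to `v` has dimension at
most that of the subspace attached to `y`, and in case of equality the stabilizers are
conjugate. -/
theorem finrank_stabilizerFixedSpace_le (ρ : G →* (E →L[ℝ] E)) {y v : E} {h : G}
    (hy : ∀ g, ρ g y = y → ρ g (ρ h v) = ρ h v) :
    finrank ℝ (stabilizerFixedSpace ρ v) ≤ finrank ℝ (stabilizerFixedSpace ρ y) ∧
    (finrank ℝ (stabilizerFixedSpace ρ y) ≤ finrank ℝ (stabilizerFixedSpace ρ v) →
      ∀ g, ρ g y = y ↔ ρ g (ρ h v) = ρ h v) := by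
  have hinj : Function.Injective (ρ h).toLinearMap := fun a b hab => by
    rw [← map_inv_apply_apply ρ h a, ← map_inv_apply_apply ρ h b]
    exact congrArg _ hab
  have hle : (stabilizerFixedSpace ρ v).map (ρ h).toLinearMap ≤ stabilizerFixedSpace ρ y := by
    rintro _ ⟨w, hw, rfl⟩ g hg
    have := hw (h⁻¹ * g * h) ((map_conj_apply_eq_iff ρ g h v).2 (hy g hg))
    exact (map_conj_apply_eq_iff ρ g h w).1 this
  have hfr : finrank ℝ ((stabilizerFixedSpace ρ v).map (ρ h).toLinearMap) =
      finrank ℝ (stabilizerFixedSpace ρ v) :=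
    ((stabilizerFixedSpace ρ v).equivMapOfInjective _ hinj).finrank_eq.symm
  refine ⟨hfr ▸ Submodule.finrank_mono hle, fun hge g => ⟨hy g, fun hg => ?_⟩⟩
  have heq := Submodule.eq_of_le_of_finrank_le hle (hge.trans hfr.ge)
  have hmem := self_mem_stabilizerFixedSpace ρ y
  rw [← heq] at hmem
  obtain ⟨w, hw, rfl⟩ := hmem
  exact (map_conj_apply_eq_iff ρ g h w).1 (hw _ ((map_conj_apply_eq_iff ρ g h v).2 hg))

/-- For almost every point `y` of an affine hyperplane, the stabilizer of `y` is conjugate to a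
subgroup of the stabilizer of `v`: the distance to the orbit of `v` is differentiable at almost
every `y`, and then `y` has a unique nearest point on this orbit. -/
theorem ae_exists_stabilizer_fixes [MeasurableSpace E] [BorelSpace E]
    [TopologicalSpace G] [CompactSpace G]
    (ρ : G →* (E →L[ℝ] E)) (hiso : ∀ g x, ‖ρ g x‖ = ‖x‖) (hcont : Continuous ρ) (e v : E)
    (μ : Measure (ℝ ∙ e)ᗮ) [μ.IsAddHaarMeasure] :
    ∀ᵐ u : (ℝ ∙ e)ᗮ ∂μ, ∃ h, ∀ g, ρ g ((u : E) + e) = (u : E) + e →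
      ρ g (ρ h v) = ρ h v := by
  revert μ
  generalize hF : (ℝ ∙ e)ᗮ = F
  intro μ _
  set O : Set E := range fun h => ρ h v
  have hOc : IsCompact O := isCompact_range (by fun_prop)
  have hOne : O.Nonempty := ⟨_, 1, rfl⟩
  set D : F → ℝ := fun u => Metric.infDist ((u : E) + e) O with hD
  have hDL : LipschitzWith 1 D := by
    have h1 : LipschitzWith 1 fun u : F => (u : E) + e :=
      LipschitzWith.of_dist_le_mul fun a b => by simp [Subtype.dist_eq]
    simpa [hD, Function.comp_def] using (Metric.lipschitz_infDist_pt O).comp h1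
  filter_upwards [hDL.ae_differentiableAt (μ := μ)] with u hu
  have huniq : ∀ p ∈ O, ∀ q ∈ O, dist ((u : E) + e) p = D u → dist ((u : E) + e) q = D u →
      p = q := by
    intro p hp q hq hpD hqD
    have hnorm : ∀ p ∈ O, ‖p‖ = ‖v‖ := by
      rintro _ ⟨h, rfl⟩; exact hiso h v
    have hdiff : ∀ p : E, DifferentiableAt ℝ (fun z : F => ‖(z : E) + e - p‖ ^ 2) u := by
      intro p
      refine DifferentiableAt.norm_sq ℝ ?_
      exact ((F.subtypeL.differentiableAt).add_const e).sub_const p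
    have hcrit : ∀ p ∈ O, dist ((u : E) + e) p = D u →
        fderiv ℝ (fun z : F => ‖(z : E) + e - p‖ ^ 2 - D z ^ 2) u = 0 := by
      intro p hp hpD
      refine IsLocalMin.fderiv_eq_zero (Eventually.of_forall fun z => ?_)
      have h1 : D z ≤ ‖(z : E) + e - p‖ := by
        rw [← dist_eq_norm]; exact Metric.infDist_le_dist_of_mem hp
      have h2 : 0 ≤ D z := Metric.infDist_nonneg
      simp only
      rw [← hpD, ← dist_eq_norm, sub_self, sub_nonneg]
      gcongr
    have hsub : fderiv ℝ (fun z : F => ‖(z : E) + e - p‖ ^ 2) u =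
        fderiv ℝ (fun z : F => ‖(z : E) + e - q‖ ^ 2) u := by
      have h1 := hcrit p hp hpD
      have h2 := hcrit q hq hqD
      rw [fderiv_fun_sub (hdiff _) (hu.fun_pow 2), sub_eq_zero] at h1 h2
      rw [h1, h2]
    have hval : ∀ (p : E) (w : F), fderiv ℝ (fun z : F => ‖(z : E) + e - p‖ ^ 2) u w =
        2 * inner ℝ ((u : E) + e - p) (w : E) := by
      intro p w
      have h1 : HasFDerivAt (fun z : F => (z : E) + e - p) F.subtypeL u :=
        (F.subtypeL.hasFDerivAt.add_const e).sub_const p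
      rw [h1.norm_sq.fderiv]
      simp [inner_sub_left, inner_add_left]
    have hperp : p - q ∈ Fᗮ := by
      intro w hw
      have h1 := hval p ⟨w, hw⟩
      rw [hsub, hval q] at h1
      simp only [inner_sub_left, inner_sub_right] at h1 ⊢
      rw [real_inner_comm p w, real_inner_comm q w]
      linarith
    have hy : inner ℝ (p - q) ((u : E) + e) = 0 := by
      have h1 := norm_sub_sq_real ((u : E) + e) p
      have h2 := norm_sub_sq_real ((u : E) + e) q
      rw [← dist_eq_norm, hpD, hnorm p hp] at h1
      rw [← dist_eq_norm, hqD, hnorm q hq] at h2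
      rw [real_inner_comm, inner_sub_right]
      linarith
    have he : inner ℝ (p - q) e = 0 := by
      have h1 : inner ℝ (u : E) (p - q) = 0 := hperp u u.2
      rw [inner_add_right, real_inner_comm, h1, zero_add] at hy
      exact hy
    have hmem : p - q ∈ F := by
      rw [← hF, Submodule.mem_orthogonal_singleton_iff_inner_left]
      exact he
    have h0 : inner ℝ (p - q) (p - q) = 0 := hperp _ hmem
    exact sub_eq_zero.1 (inner_self_eq_zero.1 h0)
  obtain ⟨p, hp, hpD⟩ := hOc.exists_infDist_eq_dist hOne ((u : E) + e)
  obtain ⟨h, rfl⟩ := hp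
  refine ⟨h, fun g hg => huniq _ ⟨g * h, map_mul_apply_eq ρ g h v⟩ _ ⟨h, rfl⟩ ?_ hpD.symm⟩
  rw [hD]
  simp only
  rw [hpD, dist_eq_norm, dist_eq_norm]
  conv_lhs => rw [← hg]
  rw [← map_sub, hiso]

omit [FiniteDimensional ℝ E] in
theorem lipschitzWith_normalize_add {e : E} (he : ‖e‖ = 1) :
    LipschitzWith 2 fun u : (ℝ ∙ e)ᗮ => ‖(u : E) + e‖⁻¹ • ((u : E) + e) := by
  have hge : ∀ u : (ℝ ∙ e)ᗮ, 1 ≤ ‖(u : E) + e‖ := by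
    intro u
    have h1 := norm_add_sq_real (u : E) e
    rw [(Submodule.mem_orthogonal_singleton_iff_inner_left).1 u.2, he] at h1
    nlinarith [norm_nonneg ((u : E) + e), sq_nonneg ‖(u : E)‖]
  refine LipschitzWith.of_dist_le_mul fun u w => ?_
  rw [Subtype.dist_eq, dist_eq_norm, dist_eq_norm]
  set a := (u : E) + e with ha
  set b := (w : E) + e with hb
  have hab : (u : E) - w = a - b := by rw [ha, hb]; abel
  have ha1 : 1 ≤ ‖a‖ := hge u
  have hb1 : 1 ≤ ‖b‖ := hge w
  have hsplit : ‖a‖⁻¹ • a - ‖b‖⁻¹ • b = ‖a‖⁻¹ • (a - b) + (‖a‖⁻¹ * (‖b‖ - ‖a‖)) • (‖b‖⁻¹ • b) := by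
    rw [smul_smul, smul_sub]
    have : ‖a‖⁻¹ * (‖b‖ - ‖a‖) * ‖b‖⁻¹ = ‖a‖⁻¹ - ‖b‖⁻¹ := by field_simp
    rw [this, sub_smul]; abel
  have hb0 : b ≠ 0 := by rintro h; rw [h, norm_zero] at hb1; norm_num at hb1
  have hb2 : ‖‖b‖⁻¹ • b‖ = 1 := norm_smul_inv_norm (𝕜 := ℝ) hb0
  have hi : ‖a‖⁻¹ ≤ 1 := inv_le_one_of_one_le₀ ha1
  have hi0 : 0 ≤ ‖a‖⁻¹ := by positivity
  have hba : |‖b‖ - ‖a‖| ≤ ‖a - b‖ := by rw [norm_sub_rev]; exact abs_norm_sub_norm_le b a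
  rw [hab, hsplit]
  refine (norm_add_le _ _).trans ?_
  rw [norm_smul, norm_smul, hb2, mul_one, norm_mul, norm_inv, norm_norm, Real.norm_eq_abs]
  have h1 : ‖a‖⁻¹ * ‖a - b‖ ≤ 1 * ‖a - b‖ := by gcongr
  have h2 : ‖a‖⁻¹ * |‖b‖ - ‖a‖| ≤ 1 * ‖a - b‖ := by gcongr
  push_cast
  linarith

/-- Points whose stabilizers are not locally constant up to conjugacy form a null set in the unit
sphere of an orthogonal representation of a compact group. -/
theorem hausdorffMeasure_sphere_not_locally_conj_eq_zero [MeasurableSpace E] [BorelSpace E]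
    [TopologicalSpace G] [CompactSpace G]
    (ρ : G →* (E →L[ℝ] E)) (hiso : ∀ g x, ‖ρ g x‖ = ‖x‖) (hcont : Continuous ρ)
    {d : ℕ} (hd : finrank ℝ E = d + 1) :
    Measure.hausdorffMeasure (d : ℝ)
      {x : E | x ∈ Metric.sphere (0 : E) 1 ∧
        ¬ ∀ᶠ z in 𝓝 x, ∃ b, ∀ g, ρ g z = z ↔ ρ g (ρ b x) = ρ b x} = 0 := by
  have : Fact (finrank ℝ E = d + 1) := ⟨hd⟩
  obtain ⟨v, hv⟩ : ∃ v, ∀ y, finrank ℝ (stabilizerFixedSpace ρ y) ≤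
      finrank ℝ (stabilizerFixedSpace ρ v) := by
    have hfin : (range fun y => finrank ℝ (stabilizerFixedSpace ρ y)).Finite :=
      (finite_Iic (finrank ℝ E)).subset <| by
        rintro _ ⟨y, rfl⟩
        exact Submodule.finrank_le _
    obtain ⟨_, ⟨v, rfl⟩, hv⟩ := hfin.exists_maximal (range_nonempty _)
    exact ⟨v, fun y => (le_total _ _).elim id fun h => hv ⟨y, rfl⟩ h⟩
  have hae : ∀ (e v : E), e ≠ 0 → ∀ᵐ u : (ℝ ∙ e)ᗮ ∂(Measure.hausdorffMeasure (d : ℝ)),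
      ∃ h, ∀ g, ρ g ((u : E) + e) = (u : E) + e → ρ g (ρ h v) = ρ h v := by
    intro e v he
    have h1 := isAddHaarMeasure_hausdorffMeasure (E := (ℝ ∙ e)ᗮ)
    rw [Submodule.finrank_orthogonal_span_singleton (n := d) he] at h1
    exact ae_exists_stabilizer_fixes ρ hiso hcont e v _
  have hprin : ∀ x : E, x ≠ 0 → finrank ℝ (stabilizerFixedSpace ρ v) ≤
      finrank ℝ (stabilizerFixedSpace ρ x) →
      ∀ᶠ z in 𝓝 x, ∃ b, ∀ g, ρ g z = z ↔ ρ g (ρ b x) = ρ b x := by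
    intro x hx0 hx
    filter_upwards [eventually_finrank_stabilizerFixedSpace_le ρ hiso hcont x] with z hz
    have hHaar := isAddHaarMeasure_hausdorffMeasure (E := (ℝ ∙ x)ᗮ)
    rw [Submodule.finrank_orthogonal_span_singleton (n := d) hx0] at hHaar
    obtain ⟨u, ⟨h, hh⟩, ⟨k, hk⟩⟩ := ((hae x x hx0).and (hae x z hx0)).exists
    have h1 := (finrank_stabilizerFixedSpace_le ρ hh).2 ((hv _).trans hx)
    have h2 := (finrank_stabilizerFixedSpace_le ρ hk).2 ((hv _).trans (hx.trans hz))
    refine ⟨k⁻¹ * h, fun g => ?_⟩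
    have h3 := (h2 (k * g * k⁻¹)).symm.trans (h1 (k * g * k⁻¹))
    rw [← map_conj_apply_eq_iff, ← map_conj_apply_eq_iff] at h3
    rw [← map_conj_apply_eq_iff]
    simpa [mul_assoc] using h3
  refine measure_null_of_locally_null _ fun x hx => ?_
  have hx1 : ‖x‖ = 1 := by simpa using hx.1
  have hx0 : x ≠ 0 := by rintro rfl; simp at hx1
  refine ⟨_, inter_mem_nhdsWithin _ ((isOpen_lt continuous_const
    (continuous_id.inner continuous_const)).mem_nhds (x := x)
    (s := {y | (0 : ℝ) < inner ℝ y x}) (by simp [hx1])), ?_⟩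
  set A : Set (ℝ ∙ x)ᗮ :=
    {u | ¬ ∃ h, ∀ g, ρ g ((u : E) + x) = (u : E) + x → ρ g (ρ h v) = ρ h v}
  have hA : Measure.hausdorffMeasure (d : ℝ) A = 0 := hae x v hx0
  refine measure_mono_null (t := (fun u : (ℝ ∙ x)ᗮ => ‖(u : E) + x‖⁻¹ • ((u : E) + x)) '' A) ?_ ?_
  · rintro y ⟨⟨hy1, hy⟩, hyx⟩
    simp only [mem_ofPred_eq] at hyx
    have hy1 : ‖y‖ = 1 := by simpa using hy1
    set t : ℝ := inner ℝ y x
    have hmem : t⁻¹ • y - x ∈ (ℝ ∙ x)ᗮ := by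
      rw [Submodule.mem_orthogonal_singleton_iff_inner_left, inner_sub_left, real_inner_smul_left,
        real_inner_self_eq_norm_sq, hx1]
      change t⁻¹ * t - 1 ^ 2 = 0
      field_simp
      norm_num
    refine ⟨⟨_, hmem⟩, ?_, ?_⟩
    · rintro ⟨h, hh⟩
      simp only [sub_add_cancel] at hh
      have h1 := (finrank_stabilizerFixedSpace_le ρ hh).1
      rw [stabilizerFixedSpace_smul ρ (inv_ne_zero hyx.ne')] at h1
      exact hy (hprin y (by rintro rfl; simp at hy1) h1)
    · simp only [sub_add_cancel]
      rw [norm_smul, hy1, smul_smul, Real.norm_of_nonneg (by positivity)]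
      simp [hyx.ne']
  · refine le_antisymm ?_ zero_le
    refine ((lipschitzWith_normalize_add hx1).hausdorffMeasure_image_le d.cast_nonneg A).trans ?_
    rw [hA, mul_zero]

end OrthogonalRepresentation

/-- For a compact (closed) subgroup `H` of the orthogonal group `O(n)` acting
on the unit sphere `S^{n-1} ⊂ ℝⁿ`, the set of principal points has full
measure with respect to the `(n-1)`-dimensional Hausdorff measure: its
complement in the sphere is null for that measure. -/
theorem sphere_principal_points_full_measure
    (n : ℕ) (hn : 2 ≤ n)
    (H : Set (Matrix (Fin n) (Fin n) ℝ))
    (h_orth : ∀ A ∈ H, A * Aᵀ = 1)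
    (h_one : (1 : Matrix (Fin n) (Fin n) ℝ) ∈ H)
    (h_mul : ∀ A ∈ H, ∀ B ∈ H, A * B ∈ H)
    (h_inv : ∀ A ∈ H, A⁻¹ ∈ H)
    (h_closed : IsClosed H) :
    (MeasureTheory.Measure.hausdorffMeasure ((n : ℝ) - 1) :
        Measure (EuclideanSpace ℝ (Fin n)))
      {x | x ∈ Metric.sphere (0 : EuclideanSpace ℝ (Fin n)) 1 ∧
        ¬ IsSpherePrincipalPt H x} = 0 := by
  obtain ⟨d, rfl⟩ : ∃ d, n = d + 1 := ⟨n - 1, by omega⟩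
  have h_unit : ∀ A ∈ H, A ∈ unitaryGroup (Fin (d + 1)) ℝ := fun A hA =>
    mem_unitaryGroup_iff.2 (h_orth A hA)
  let G : Subgroup (unitaryGroup (Fin (d + 1)) ℝ) :=
    { carrier := {U | (U : Matrix (Fin (d + 1)) (Fin (d + 1)) ℝ) ∈ H}
      mul_mem' := fun ha hb => h_mul _ ha _ hb
      one_mem' := h_one
      inv_mem' := fun {U} hU => by
        have h1 := h_inv _ hU
        rwa [inv_eq_right_inv (mem_unitaryGroup_iff.1 U.2)] at h1 }
  let ι : G → Matrix (Fin (d + 1)) (Fin (d + 1)) ℝ := fun g => g.1.1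
  have hι_range : range ι = H := by
    ext A
    exact ⟨by rintro ⟨g, rfl⟩; exact g.2, fun hA => ⟨⟨⟨A, h_unit A hA⟩, hA⟩, rfl⟩⟩
  have hH : IsCompact H := by
    have hK : IsCompact (univ.pi fun _ => univ.pi fun _ => Icc (-1) 1 :
        Set (Matrix (Fin (d + 1)) (Fin (d + 1)) ℝ)) :=
      isCompact_univ_pi fun _ => isCompact_univ_pi fun _ => isCompact_Icc
    refine hK.of_isClosed_subset h_closed fun A hA i _ j _ => ?_
    exact abs_le.1 (entry_norm_bound_of_unitary (h_unit A hA) i j)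
  have hι_ind : Topology.IsInducing ι :=
    Topology.IsInducing.subtypeVal.comp Topology.IsInducing.subtypeVal
  have : CompactSpace G := by
    rw [← isCompact_univ_iff, hι_ind.isCompact_iff, image_univ, hι_range]
    exact hH
  let T := toEuclideanCLM (n := Fin (d + 1)) (𝕜 := ℝ)
  let ρ : G →* (EuclideanSpace ℝ (Fin (d + 1)) →L[ℝ] EuclideanSpace ℝ (Fin (d + 1))) :=
    (T : _ →* _).comp ((unitaryGroup (Fin (d + 1)) ℝ).subtype.comp G.subtype)
  have hcont : Continuous ρ := by
    have h1 : Continuous T := T.toAlgEquiv.toLinearMap.continuous_of_finiteDimensional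
    exact h1.comp hι_ind.continuous
  have hiso : ∀ g x, ‖ρ g x‖ = ‖x‖ := by
    intro g x
    have h1 : ρ g ∈ unitary _ := Unitary.map_mem T g.1.2
    exact ContinuousLinearMap.norm_map_of_mem_unitary h1 x
  have hmain := hausdorffMeasure_sphere_not_locally_conj_eq_zero ρ hiso hcont
    (d := d) (by simp)
  rw [show ((d + 1 : ℕ) : ℝ) - 1 = d by push_cast; ring]
  refine measure_mono_null ?_ hmain
  rintro x ⟨hx1, hx2⟩
  refine ⟨hx1, fun hx' => hx2 ?_⟩
  obtain ⟨U, hU, hUo, hxU⟩ := eventually_nhds_iff.1 hx'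
  refine ⟨U, hUo, hxU, fun y hy => ?_⟩
  obtain ⟨b, hb⟩ := hU y hy.1
  have hmem : ∀ g z, ι g ∈ sphereStabilizer H z ↔ ρ g z = z := fun g z =>
    ⟨fun h => h.2, fun h => ⟨g.2, h⟩⟩
  have hsurj : ∀ z, ∀ A ∈ sphereStabilizer H z, ∃ g, ι g = A := fun z A hA =>
    hι_range.ge hA.1
  have hconj : ∀ g, ι b * ι g * (ι b)⁻¹ = ι (b * g * b⁻¹) := fun g => by
    rw [inv_eq_right_inv (mem_unitaryGroup_iff.1 b.1.2)]
    rfl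
  refine ⟨ι b, b.2, ?_⟩
  ext A
  constructor
  · intro hA
    obtain ⟨g, rfl⟩ := hsurj y A hA
    refine ⟨ι (b⁻¹ * g * b), ?_, ?_⟩
    · rw [hmem, map_conj_apply_eq_iff, ← hb, ← hmem]
      exact hA
    · simp only [hconj]
      congr 1
      group
  · rintro ⟨C, hC, rfl⟩
    obtain ⟨g, rfl⟩ := hsurj x C hC
    simp only [hconj]
    rw [hmem, hb, ← map_conj_apply_eq_iff, ← hmem]
    convert hC using 2
    group
end
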